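/- Let ρ : ℝ × ℝ³ → ℝ and J : ℝ × ℝ³ → ℝ³ be smooth with compact support, satisfying the continuity equation ∂ρ/∂t + div J = 0 everywhere. For x ≠ y write 𝔯 = |x − y|, r̂ = (x − y)/𝔯 and t_r = t − 𝔯/c, and define the Jefimenko fields E(t, x) = (1/(4πε₀)) ∫_{ℝ³} [ (ρ(t_r, y)/𝔯²) r̂ + ((∂ρ/∂t)(t_r, y)/(c𝔯)) r̂ − (∂J/∂t)(t_r, y)/(c²𝔯) ] dy and B(t, x) = (μ₀/(4π)) ∫_{ℝ³} [ J(t_r, y)/𝔯² + (∂J/∂t)(t_r, y)/(c𝔯) ] × r̂ dy. Then E and B are smooth and (ρ, J, E, B) satisfies Maxwell's equations. -/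

import Mathlib

noncomputable section

open Real MeasureTheory Filter

/-- Physical space `ℝ³`. -/
abbrev V3 : Type := Fin 3 → ℝ

/-- Partial derivative with respect to the time variable. -/
def ptd {E : Type} [NormedAddCommGroup E] [NormedSpace ℝ E]
    (f : ℝ × V3 → E) : ℝ × V3 → E :=
  fun p => deriv (fun s => f (s, p.2)) p.1

/-- Partial derivative in the `i`-th spatial direction. -/
def pxd {E : Type} [NormedAddCommGroup E] [NormedSpace ℝ E]
    (i : Fin 3) (f : ℝ × V3 → E) : ℝ × V3 → E :=
  fun p => fderiv ℝ (fun y => f (p.1, y)) p.2 (Pi.single i (1 : ℝ))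

/-- Spatial Laplacian. -/
def lap {E : Type} [NormedAddCommGroup E] [NormedSpace ℝ E]
    (f : ℝ × V3 → E) : ℝ × V3 → E :=
  fun p => ∑ i : Fin 3, pxd i (pxd i f) p

/-- Spatial divergence of a vector field. -/
def divg (F : ℝ × V3 → V3) : ℝ × V3 → ℝ :=
  fun p => ∑ i : Fin 3, pxd i (fun q => F q i) p

/-- Spatial curl of a vector field. -/
def curl (F : ℝ × V3 → V3) : ℝ × V3 → V3 :=
  fun p => ![pxd 1 (fun q => F q 2) p - pxd 2 (fun q => F q 1) p,
             pxd 2 (fun q => F q 0) p - pxd 0 (fun q => F q 2) p,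
             pxd 0 (fun q => F q 1) p - pxd 1 (fun q => F q 0) p]

/-- Spatial gradient of a scalar field. -/
def grad (f : ℝ × V3 → ℝ) : ℝ × V3 → V3 :=
  fun p i => pxd i f p

/-- The d'Alembertian `□² = Δ - μ₀ε₀ ∂²/∂t²`. -/
def box (μ₀ ε₀ : ℝ) {E : Type} [NormedAddCommGroup E] [NormedSpace ℝ E]
    (f : ℝ × V3 → E) : ℝ × V3 → E :=
  fun p => lap f p - (μ₀ * ε₀) • ptd (ptd f) p

/-- Maxwell's equations for charge `ρ`, current `J` and fields `E`, `B`. -/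
def Maxwell (ε₀ μ₀ : ℝ) (ρ : ℝ × V3 → ℝ) (J E B : ℝ × V3 → V3) : Prop :=
  ∀ p : ℝ × V3,
    divg E p = ρ p / ε₀ ∧ divg B p = 0 ∧
    curl E p = -(ptd B p) ∧
    curl B p = μ₀ • J p + (μ₀ * ε₀) • ptd E p

/-- `f` is Schwartz in the spatial variable, locally uniformly in time. -/
def SchwartzLocUnif {E : Type} [NormedAddCommGroup E] [NormedSpace ℝ E]
    (f : ℝ × V3 → E) : Prop :=
  ∀ (α β : Fin 3 → ℕ) (j : ℕ) (R : ℝ), ∃ C : ℝ, ∀ p : ℝ × V3, |p.1| ≤ R →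
    |∏ i : Fin 3, p.2 i ^ α i| *
      ‖(ptd^[j] ((pxd 0)^[β 0] ((pxd 1)^[β 1] ((pxd 2)^[β 2] f)))) p‖ ≤ C

/-- Euclidean norm on `ℝ³`. -/
def norm3 (x : V3) : ℝ := Real.sqrt (∑ i : Fin 3, x i ^ 2)

/-- Dot product on `ℝ³`. -/
def dot3 (x y : V3) : ℝ := ∑ i : Fin 3, x i * y i

/-- Cross product on `ℝ³`. -/
def cross3 (a b : V3) : V3 :=
  ![a 1 * b 2 - a 2 * b 1, a 2 * b 0 - a 0 * b 2, a 0 * b 1 - a 1 * b 0]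

/-- The Lorentz factor `γ_v`. -/
def gam (c : ℝ) (v : V3) : ℝ := 1 / Real.sqrt (1 - norm3 v ^ 2 / c ^ 2)

/-- The Lorentz boost `Λ_v` with velocity `v`. -/
def boost (c : ℝ) (v : V3) (p : ℝ × V3) : ℝ × V3 :=
  (gam c v * (p.1 - dot3 v p.2 / c ^ 2),
   p.2 + ((gam c v - 1) * dot3 v p.2 / norm3 v ^ 2 - gam c v * p.1) • v)

/-- Transformed charge `ρ'_v`, i.e. the function with
`ρ'_v (Λ_v p) = γ_v (ρ p - v·J p / c²)`. -/
def rhoTr (c : ℝ) (v : V3) (ρ : ℝ × V3 → ℝ) (J : ℝ × V3 → V3) : ℝ × V3 → ℝ :=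
  fun p => gam c v * (ρ (boost c (-v) p) - dot3 v (J (boost c (-v) p)) / c ^ 2)

/-- Transformed current `J'_v`, i.e. the function with
`J'_v (Λ_v p) = J p + ((γ_v - 1)(v·J p)/|v|² - γ_v ρ p) v`. -/
def JTr (c : ℝ) (v : V3) (ρ : ℝ × V3 → ℝ) (J : ℝ × V3 → V3) : ℝ × V3 → V3 :=
  fun p => J (boost c (-v) p) +
    ((gam c v - 1) * dot3 v (J (boost c (-v) p)) / norm3 v ^ 2
      - gam c v * ρ (boost c (-v) p)) • v

/-- Transformed electric field `E''_v`, i.e. the function with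
`E''_v (Λ_v p) = E_∥ p + γ_v E_⊥ p`. -/
def ETr (c : ℝ) (v : V3) (E : ℝ × V3 → V3) : ℝ × V3 → V3 :=
  fun p =>
    (dot3 (E (boost c (-v) p)) v / norm3 v ^ 2) • v +
    gam c v • (E (boost c (-v) p) - (dot3 (E (boost c (-v) p)) v / norm3 v ^ 2) • v)

/-- Spatial gradient of a complex scalar field. -/
def gradC (f : ℝ × V3 → ℂ) : ℝ × V3 → Fin 3 → ℂ :=
  fun p i => pxd i f p

/-- Spatial divergence of a complex vector field. -/
def divgC (F : ℝ × V3 → Fin 3 → ℂ) : ℝ × V3 → ℂ :=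
  fun p => ∑ i : Fin 3, pxd i (fun q => F q i) p

open scoped Topology ContDiff

/-- Directional derivative of a scalar field along a fixed space-time vector. -/
def dirDeriv (v : ℝ × V3) (f : ℝ × V3 → ℝ) : ℝ × V3 → ℝ := fun p => fderiv ℝ f p v

/-- The unit vector in the time direction. -/
def eTime : ℝ × V3 := (1, 0)

/-- The unit vector in the `i`-th spatial direction. -/
def eSpace (i : Fin 3) : ℝ × V3 := (0, Pi.single i 1)

/-- The regularised Euclidean norm `√(|z|² + δ²)`. -/
def softNorm (δ : ℝ) (z : V3) : ℝ := Real.sqrt (∑ i : Fin 3, z i ^ 2 + δ ^ 2)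

/-- The field `f` at the (regularised) retarded time, at displacement `z` from `p`. -/
def retEval (c δ : ℝ) (f : ℝ × V3 → ℝ) (p : ℝ × V3) (z : V3) : ℝ :=
  f (p.1 - softNorm δ z / c, p.2 - z)

/-- The model singularity `1 + |z|⁻²` dominating all kernels in use. -/
def singBound (z : V3) : ℝ := 1 + (norm3 z ^ 2)⁻¹

/-- The retarded potential of `f` with kernel `K`. -/
def retPot (c : ℝ) (K : V3 → ℝ) (f : ℝ × V3 → ℝ) (p : ℝ × V3) : ℝ :=
  ∫ z, K z * retEval c 0 f p z

lemma norm3_nonneg (z : V3) : 0 ≤ norm3 z := Real.sqrt_nonneg _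

lemma norm3_sq (z : V3) : norm3 z ^ 2 = ∑ i : Fin 3, z i ^ 2 :=
  Real.sq_sqrt (Finset.sum_nonneg fun i _ => sq_nonneg (z i))

@[fun_prop]
lemma continuous_norm3 : Continuous norm3 := by unfold norm3; fun_prop

lemma norm3_pos {z : V3} (hz : z ≠ 0) : 0 < norm3 z := by
  refine (norm3_nonneg z).lt_of_ne fun h => hz ?_
  have h2 := norm3_sq z
  rw [← h, zero_pow two_ne_zero, eq_comm,
    Finset.sum_eq_zero_iff_of_nonneg fun i _ => sq_nonneg (z i)] at h2
  ext i
  simpa using h2 i (Finset.mem_univ i)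

lemma softNorm_zero (z : V3) : softNorm 0 z = norm3 z := by simp [softNorm, norm3]

lemma softNorm_sq (δ : ℝ) (z : V3) : softNorm δ z ^ 2 = ∑ i : Fin 3, z i ^ 2 + δ ^ 2 :=
  Real.sq_sqrt (add_nonneg (Finset.sum_nonneg fun i _ => sq_nonneg (z i)) (sq_nonneg δ))

@[fun_prop]
lemma continuous_softNorm (δ : ℝ) : Continuous (softNorm δ) := by unfold softNorm; fun_prop

@[fun_prop]
lemma continuous_softNorm_left (z : V3) : Continuous fun δ => softNorm δ z := by
  unfold softNorm; fun_prop

lemma norm3_le_softNorm (δ : ℝ) (z : V3) : norm3 z ≤ softNorm δ z :=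
  Real.sqrt_le_sqrt (by nlinarith [sq_nonneg δ])

lemma softNorm_nonneg (δ : ℝ) (z : V3) : 0 ≤ softNorm δ z := Real.sqrt_nonneg _

lemma softNorm_pos {δ : ℝ} (hδ : δ ≠ 0) (z : V3) : 0 < softNorm δ z := by
  refine Real.sqrt_pos.2 (add_pos_of_nonneg_of_pos ?_ (by positivity))
  exact Finset.sum_nonneg fun i _ => sq_nonneg (z i)

lemma softNorm_pos_of_ne {z : V3} (hz : z ≠ 0) (δ : ℝ) : 0 < softNorm δ z :=
  (norm3_pos hz).trans_le (norm3_le_softNorm δ z)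

lemma abs_apply_le_softNorm (δ : ℝ) (z : V3) (i : Fin 3) : |z i| ≤ softNorm δ z := by
  refine Real.abs_le_sqrt ?_
  have := Finset.single_le_sum (f := fun i => z i ^ 2) (fun i _ => sq_nonneg (z i))
    (Finset.mem_univ i)
  nlinarith [sq_nonneg δ]

lemma norm_le_norm3 (z : V3) : ‖z‖ ≤ norm3 z := by
  refine (pi_norm_le_iff_of_nonneg (norm3_nonneg z)).2 fun i => ?_
  simpa [softNorm_zero] using abs_apply_le_softNorm 0 z i

lemma softNorm_smul_self {δ : ℝ} (hδ : 0 ≤ δ) (w : V3) :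
    softNorm δ (δ • w) = δ * softNorm 1 w := by
  rw [softNorm, softNorm, ← Real.sqrt_sq hδ, ← Real.sqrt_mul (sq_nonneg δ), Real.sqrt_sq hδ]
  congr 1
  simp [mul_pow, mul_add, Finset.mul_sum]

lemma inv_softNorm_sq_le {z : V3} (hz : z ≠ 0) (δ : ℝ) :
    (softNorm δ z ^ 2)⁻¹ ≤ singBound z := by
  have h := norm3_pos hz
  have h2 := norm3_le_softNorm δ z
  have : (softNorm δ z ^ 2)⁻¹ ≤ (norm3 z ^ 2)⁻¹ := by gcongr
  unfold singBound; linarith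

lemma inv_softNorm_le {z : V3} (hz : z ≠ 0) (δ : ℝ) : (softNorm δ z)⁻¹ ≤ singBound z := by
  have h := norm3_pos hz
  have h2 := norm3_le_softNorm δ z
  have : (softNorm δ z)⁻¹ ≤ (norm3 z)⁻¹ := by gcongr
  unfold singBound
  rw [← inv_pow]
  nlinarith [sq_nonneg ((norm3 z)⁻¹ - 1)]

lemma locallyIntegrable_singBound : LocallyIntegrable singBound := by
  refine (locallyIntegrable_const 1).add ?_
  refine locallyIntegrable_of_norm_le_rpow (C := 1) (α := 2) (by simp) (by simp; norm_num)
    (ae_of_all _ fun z => ?_) (by fun_prop)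
  rcases eq_or_ne z 0 with rfl | hz
  · simp [norm3]
  · have := norm_pos_iff.2 hz
    have h2 := norm_le_norm3 z
    rw [Real.rpow_neg (norm_nonneg z), one_mul, Real.norm_of_nonneg (by positivity)]
    simp only [Real.rpow_ofNat]
    gcongr

lemma ae_ne_zero : ∀ᵐ z : V3, z ≠ 0 := by
  simp [ae_iff]

lemma locallyIntegrable_of_le_singBound {K : V3 → ℝ} {C : ℝ} (hK : Measurable K)
    (hb : ∀ z ≠ 0, |K z| ≤ C * singBound z) : LocallyIntegrable K := by
  refine (locallyIntegrable_singBound.smul C).mono hK.aestronglyMeasurable ?_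
  filter_upwards [ae_ne_zero] with z hz
  exact (hb z hz).trans (le_abs_self _)

@[fun_prop]
lemma continuous_retEval {c δ : ℝ} {f : ℝ × V3 → ℝ} (hf : Continuous f) (p : ℝ × V3) :
    Continuous (retEval c δ f p) := by
  unfold retEval; fun_prop

lemma exists_retEval_bound {f : ℝ × V3 → ℝ} (hf : Continuous f) (hs : HasCompactSupport f)
    (p : ℝ × V3) : ∃ M : ℝ, ∃ S : Set V3, 0 ≤ M ∧ IsCompact S ∧
      ∀ c δ z, |retEval c δ f p z| ≤ S.indicator (fun _ => M) z := by
  obtain ⟨M, hM⟩ := hs.exists_bound_of_continuous hf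
  refine ⟨M, (fun q : ℝ × V3 => p.2 - q.2) '' tsupport f, (norm_nonneg _).trans (hM 0),
    hs.isCompact.image (by fun_prop), fun c δ z => ?_⟩
  by_cases hz : z ∈ (fun q : ℝ × V3 => p.2 - q.2) '' tsupport f
  · rw [Set.indicator_of_mem hz]; exact hM _
  · rw [Set.indicator_of_notMem hz, retEval,
      image_eq_zero_of_notMem_tsupport (f := f) fun h => hz ⟨_, h, by simp⟩, abs_zero]

lemma hasCompactSupport_retEval {c δ : ℝ} {f : ℝ × V3 → ℝ} (hf : Continuous f)
    (hs : HasCompactSupport f) (p : ℝ × V3) : HasCompactSupport (retEval c δ f p) := by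
  obtain ⟨M, S, -, hS, h⟩ := exists_retEval_bound hf hs p
  refine HasCompactSupport.intro hS fun z hz => ?_
  simpa [hz] using h c δ z

lemma integrable_indicator_mul_singBound (M : ℝ) {S : Set V3} (hS : IsCompact S) (C : ℝ) :
    Integrable fun z => C * singBound z * S.indicator (fun _ => M) z := by
  have := ((locallyIntegrable_singBound.integrableOn_isCompact hS).const_mul C).mul_const M
  refine ((integrable_indicator_iff hS.measurableSet).2 this).congr (ae_of_all _ fun z => ?_)
  by_cases hz : z ∈ S <;> simp [hz]

lemma tendsto_integral_retEval {c : ℝ} {f : ℝ × V3 → ℝ} (hf : Continuous f)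
    (hs : HasCompactSupport f) (p : ℝ × V3) {K : ℝ → V3 → ℝ} {C : ℝ}
    (hK : ∀ δ, Measurable (K δ)) (hb : ∀ δ, ∀ z ≠ 0, |K δ z| ≤ C * singBound z)
    (hlim : ∀ z ≠ 0, ContinuousAt (fun δ => K δ z) 0) :
    Tendsto (fun δ => ∫ z, K δ z * retEval c δ f p z) (𝓝[>] 0)
      (𝓝 (retPot c (K 0) f p)) := by
  obtain ⟨M, S, hM, hS, h⟩ := exists_retEval_bound hf hs p
  refine tendsto_integral_filter_of_dominated_convergence
    (fun z => C * singBound z * S.indicator (fun _ => M) z) (Eventually.of_forall fun δ => ?_)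
    (Eventually.of_forall fun δ => ?_) (integrable_indicator_mul_singBound M hS C) ?_
  · have := continuous_retEval (c := c) (δ := δ) hf p
    exact (hK δ).aestronglyMeasurable.mul this.aestronglyMeasurable
  · filter_upwards [ae_ne_zero] with z hz
    rw [norm_mul]
    exact mul_le_mul (hb δ z hz) (h c δ z) (abs_nonneg _) ((abs_nonneg _).trans (hb δ z hz))
  · filter_upwards [ae_ne_zero] with z hz
    refine ((hlim z hz).tendsto.mono_left nhdsWithin_le_nhds).mul ?_
    have : Continuous fun δ => retEval c δ f p z := by unfold retEval; fun_prop
    exact (this.tendsto 0).mono_left nhdsWithin_le_nhds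

lemma integrable_mul_retEval {c : ℝ} {f : ℝ × V3 → ℝ} (hf : Continuous f)
    (hs : HasCompactSupport f) (p : ℝ × V3) {K : V3 → ℝ} {C : ℝ}
    (hK : Measurable K) (hb : ∀ z ≠ 0, |K z| ≤ C * singBound z) :
    Integrable fun z => K z * retEval c 0 f p z := by
  have h1 := continuous_retEval (c := c) (δ := 0) hf p
  obtain ⟨M, S, hM, hS, h⟩ := exists_retEval_bound hf hs p
  refine (integrable_indicator_mul_singBound M hS C).mono'
    (hK.aestronglyMeasurable.mul h1.aestronglyMeasurable) ?_
  filter_upwards [ae_ne_zero] with z hz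
  rw [norm_mul]
  exact mul_le_mul (hb z hz) (h c 0 z) (abs_nonneg _) ((abs_nonneg _).trans (hb z hz))

section Smoothness

/-- The graph of the backward light cone. -/
def coneMap (c : ℝ) (z : V3) : ℝ × V3 := (norm3 z / c, z)

lemma measurableEmbedding_coneMap (c : ℝ) : MeasurableEmbedding (coneMap c) := by
  have h : Function.LeftInverse Prod.snd (coneMap c) := fun z => rfl
  refine (h.isClosedEmbedding continuous_snd ?_).measurableEmbedding
  unfold coneMap; fun_prop

lemma locallyIntegrable_cone {c C : ℝ} {K : V3 → ℝ} (hK : Measurable K)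
    (hb : ∀ z ≠ 0, |K z| ≤ C * singBound z) :
    LocallyIntegrable (fun q : ℝ × V3 => K q.2) (volume.map (coneMap c)) := by
  rw [locallyIntegrable_iff]
  intro k hk
  rw [(measurableEmbedding_coneMap c).integrableOn_map_iff]
  refine ((locallyIntegrable_of_le_singBound hK hb).integrableOn_isCompact
    (hk.image continuous_snd)).mono_set fun z hz => ⟨_, hz, rfl⟩

lemma retPot_eq_convolution (c : ℝ) (K : V3 → ℝ) (f : ℝ × V3 → ℝ) :
    retPot c K f = convolution (fun q : ℝ × V3 => K q.2) f (ContinuousLinearMap.mul ℝ ℝ)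
      (volume.map (coneMap c)) := by
  ext p
  rw [convolution, (measurableEmbedding_coneMap c).integral_map]
  simp [retPot, retEval, coneMap, softNorm_zero]
  rfl

lemma contDiff_retPot {c C : ℝ} {K : V3 → ℝ} (hK : Measurable K)
    (hb : ∀ z ≠ 0, |K z| ≤ C * singBound z) {f : ℝ × V3 → ℝ} (hf : ContDiff ℝ ∞ f)
    (hs : HasCompactSupport f) : ContDiff ℝ ∞ (retPot c K f) := by
  rw [retPot_eq_convolution]
  exact hs.contDiff_convolution_right _ (locallyIntegrable_cone hK hb) hf

lemma dirDeriv_retPot {c C : ℝ} {K : V3 → ℝ} (hK : Measurable K)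
    (hb : ∀ z ≠ 0, |K z| ≤ C * singBound z) {f : ℝ × V3 → ℝ} (hf : ContDiff ℝ ∞ f)
    (hs : HasCompactSupport f) (v : ℝ × V3) :
    dirDeriv v (retPot c K f) = retPot c K (dirDeriv v f) := by
  ext p
  have hl := locallyIntegrable_cone (c := c) hK hb
  have hF : ContDiff ℝ 1 (Function.uncurry fun _ : ℝ => f) :=
    (hf.of_le (by norm_cast)).comp contDiff_snd
  have h := hasFDerivAt_convolution_right_with_param (ContinuousLinearMap.mul ℝ ℝ)
    (g := fun _ : ℝ => f) isOpen_univ hs.isCompact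
    (fun _ x _ hx => image_eq_zero_of_notMem_tsupport hx) hl hF.contDiffOn ((0 : ℝ), p)
    (Set.mem_univ _)
  have h2 := h.comp p (hasFDerivAt_prodMk_right (0 : ℝ) p)
  have hg : (fun x => fderiv ℝ (Function.uncurry fun _ : ℝ => f) ((0 : ℝ), x)) =
      fun x => (fderiv ℝ f x).comp (ContinuousLinearMap.snd ℝ ℝ (ℝ × V3)) := by
    ext1 x
    exact (((hf.differentiable (by simp)) x).hasFDerivAt.comp ((0 : ℝ), x) hasFDerivAt_snd).fderiv
  have hcont : Continuous (fderiv ℝ f) := hf.continuous_fderiv (by simp)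
  rw [retPot_eq_convolution, retPot_eq_convolution, dirDeriv]
  refine (congrArg (fun L => L v) h2.fderiv).trans ?_
  change (convolution (fun q : ℝ × V3 => K q.2)
    (fun x => fderiv ℝ (Function.uncurry fun _ : ℝ => f) ((0 : ℝ), x))
    ((ContinuousLinearMap.mul ℝ ℝ).precompR (ℝ × ℝ × V3)) _ p) ((0 : ℝ), v) = _
  rw [hg, convolution_precompR_apply _ hl]
  · rfl
  · exact (hs.fderiv (𝕜 := ℝ)).comp_left (g := fun L : ℝ × V3 →L[ℝ] ℝ =>
      L.comp (ContinuousLinearMap.snd ℝ ℝ (ℝ × V3))) (by simp)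
  · exact hcont.clm_comp continuous_const

end Smoothness

section IntegrationByParts

lemma sum_sq_add_single (z : V3) (i : Fin 3) (τ : ℝ) :
    ∑ j : Fin 3, (z + τ • Pi.single i (1 : ℝ) : V3) j ^ 2 =
      ∑ j : Fin 3, z j ^ 2 + 2 * τ * z i + τ ^ 2 := by
  fin_cases i <;> simp [Fin.sum_univ_three] <;> ring

lemma hasDerivAt_softNorm {δ : ℝ} (hδ : δ ≠ 0) (z : V3) (i : Fin 3) :
    HasDerivAt (fun τ : ℝ => softNorm δ (z + τ • Pi.single i (1 : ℝ))) (z i / softNorm δ z) 0 := by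
  have h : HasDerivAt (fun τ : ℝ => ∑ j : Fin 3, z j ^ 2 + 2 * τ * z i + τ ^ 2 + δ ^ 2)
      (2 * z i) 0 := by
    have h1 := ((((hasDerivAt_id (0 : ℝ)).const_mul 2).mul_const (z i)).const_add
      (∑ j : Fin 3, z j ^ 2)).add (hasDerivAt_pow 2 (0 : ℝ))
    simpa using h1.add_const (δ ^ 2)
  have hs := softNorm_pos hδ z
  have h2 := h.sqrt (by simpa [softNorm_sq] using (pow_pos hs 2).ne')
  simp only [softNorm, sum_sq_add_single]
  refine h2.congr_deriv ?_
  simp [mul_div_mul_left]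

lemma hasDerivAt_coord (z : V3) (i : Fin 3) :
    HasDerivAt (fun τ : ℝ => (z + τ • Pi.single i (1 : ℝ) : V3) i) 1 0 := by
  simpa using (hasDerivAt_id (0 : ℝ)).const_add (z i)

lemma hasDerivAt_retEval {c δ : ℝ} (hδ : δ ≠ 0) {f : ℝ × V3 → ℝ} (hf : Differentiable ℝ f)
    (p : ℝ × V3) (z : V3) (i : Fin 3) :
    HasDerivAt (fun τ : ℝ => retEval c δ f p (z + τ • Pi.single i (1 : ℝ)))
      (-retEval c δ (dirDeriv (eSpace i) f) p z
        - z i / (c * softNorm δ z) * retEval c δ (dirDeriv eTime f) p z) 0 := by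
  have h1 : HasDerivAt (fun τ : ℝ => (p.1 - softNorm δ (z + τ • Pi.single i (1 : ℝ)) / c,
      p.2 - (z + τ • Pi.single i (1 : ℝ))))
      (-(z i / softNorm δ z / c), -(Pi.single i (1 : ℝ))) 0 := by
    refine (((hasDerivAt_softNorm hδ z i).div_const c).const_sub p.1).prodMk ?_
    have := ((hasDerivAt_id (0 : ℝ)).smul_const (Pi.single i (1 : ℝ) : V3)).const_add z
    simpa using this.const_sub p.2
  have h2 := (hf (p.1 - softNorm δ z / c, p.2 - z)).hasFDerivAt.comp_hasDerivAt_of_eq (0 : ℝ) h1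
    (by simp)
  refine h2.congr_deriv ?_
  have : ((-(z i / softNorm δ z / c), -(Pi.single i (1 : ℝ))) : ℝ × V3) =
      -eSpace i - (z i / (c * softNorm δ z)) • eTime := by
    ext j
    · simp [eSpace, eTime]; ring
    · simp [eSpace, eTime]
  rw [this]
  simp [retEval, dirDeriv]

/-- `g` is integrable with integral `a`. -/
def HasIntegralEq (g : V3 → ℝ) (a : ℝ) : Prop := Integrable g ∧ ∫ z, g z = a

lemma hasIntegralEq_integral {g : V3 → ℝ} (hg : Integrable g) : HasIntegralEq g (∫ z, g z) :=
  ⟨hg, rfl⟩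

namespace HasIntegralEq

variable {g h : V3 → ℝ} {a b : ℝ}

lemma neg (hg : HasIntegralEq g a) : HasIntegralEq (fun z => -g z) (-a) :=
  ⟨hg.1.neg, by rw [integral_neg, hg.2]⟩

lemma add (hg : HasIntegralEq g a) (hh : HasIntegralEq h b) :
    HasIntegralEq (fun z => g z + h z) (a + b) :=
  ⟨hg.1.add hh.1, by rw [integral_add hg.1 hh.1, hg.2, hh.2]⟩

lemma sub (hg : HasIntegralEq g a) (hh : HasIntegralEq h b) :
    HasIntegralEq (fun z => g z - h z) (a - b) :=
  ⟨hg.1.sub hh.1, by rw [integral_sub hg.1 hh.1, hg.2, hh.2]⟩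

lemma const_mul (hg : HasIntegralEq g a) (k : ℝ) : HasIntegralEq (fun z => k * g z) (k * a) :=
  ⟨hg.1.const_mul k, by rw [integral_const_mul, hg.2]⟩

lemma sum {g : Fin 3 → V3 → ℝ} {a : Fin 3 → ℝ} (hg : ∀ i, HasIntegralEq (g i) (a i)) :
    HasIntegralEq (fun z => ∑ i, g i z) (∑ i, a i) :=
  ⟨integrable_finsetSum _ fun i _ => (hg i).1, by
    rw [integral_finsetSum _ fun i _ => (hg i).1]
    exact Finset.sum_congr rfl fun i _ => (hg i).2⟩

lemma unique (hg : HasIntegralEq g a) (hh : HasIntegralEq h b) (H : ∀ z, g z = h z) : a = b := by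
  rw [← hg.2, ← hh.2, funext H]

end HasIntegralEq

lemma integral_lineDeriv_eq_zero {g g' : V3 → ℝ} {v : V3} (hg : Integrable g)
    (hg' : Integrable g') (h : ∀ z, HasLineDerivAt ℝ g (g' z) z v) : ∫ z, g' z = 0 := by
  have := integral_bilinear_hasLineDerivAt_right_eq_neg_left_of_integrable (μ := volume)
    (f := fun _ : V3 => (1 : ℝ)) (f' := fun _ => 0) (g := g) (g' := g') (v := v)
    (B := ContinuousLinearMap.mul ℝ ℝ) (by simp) (by simpa) (by simpa)
    (fun z _ => by simpa [HasLineDerivAt] using hasDerivAt_const (0 : ℝ) (1 : ℝ))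
    (fun z _ => h z)
  simpa using this

lemma dirDeriv_contDiff {f : ℝ × V3 → ℝ} (hf : ContDiff ℝ ∞ f) (v : ℝ × V3) :
    ContDiff ℝ ∞ (dirDeriv v f) :=
  (hf.fderiv_right (m := ∞) (by simp)).clm_apply contDiff_const

lemma dirDeriv_hasCompactSupport {f : ℝ × V3 → ℝ} (hf : HasCompactSupport f) (v : ℝ × V3) :
    HasCompactSupport (dirDeriv v f) :=
  hf.fderiv_apply (𝕜 := ℝ) v

lemma integrable_continuous_mul_retEval {c δ : ℝ} {f : ℝ × V3 → ℝ} (hf : Continuous f)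
    (hs : HasCompactSupport f) (p : ℝ × V3) {K : V3 → ℝ} (hK : Continuous K) :
    Integrable fun z => K z * retEval c δ f p z :=
  (hK.mul (continuous_retEval hf p)).integrable_of_hasCompactSupport
    (hasCompactSupport_retEval hf hs p).mul_left

@[fun_prop]
lemma continuous_inv_softNorm {δ : ℝ} (hδ : δ ≠ 0) : Continuous fun z => (softNorm δ z)⁻¹ :=
  (continuous_softNorm δ).inv₀ fun z => (softNorm_pos hδ z).ne'

lemma integral_parts_retEval {c δ : ℝ} (hδ : δ ≠ 0) {f : ℝ × V3 → ℝ} (hf : ContDiff ℝ ∞ f)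
    (hs : HasCompactSupport f) (p : ℝ × V3) (i : Fin 3) {K K' : V3 → ℝ} (hK : Continuous K)
    (hK' : Continuous K')
    (hd : ∀ z, HasDerivAt (fun τ : ℝ => K (z + τ • Pi.single i (1 : ℝ))) (K' z) 0) :
    HasIntegralEq (fun z => K' z * retEval c δ f p z -
      (K z * retEval c δ (dirDeriv (eSpace i) f) p z +
        (z i * (softNorm δ z)⁻¹ * c⁻¹ * K z) * retEval c δ (dirDeriv eTime f) p z)) 0 := by
  have hK2 : Continuous fun z : V3 => z i * (softNorm δ z)⁻¹ * c⁻¹ * K z := by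
    have := continuous_inv_softNorm hδ
    fun_prop
  have i1 := integrable_continuous_mul_retEval (c := c) (δ := δ) hf.continuous hs p hK'
  have i2 := integrable_continuous_mul_retEval (c := c) (δ := δ)
    (dirDeriv_contDiff hf (eSpace i)).continuous (dirDeriv_hasCompactSupport hs (eSpace i)) p hK
  have i3 := integrable_continuous_mul_retEval (c := c) (δ := δ)
    (dirDeriv_contDiff hf eTime).continuous (dirDeriv_hasCompactSupport hs eTime) p hK2
  refine ⟨i1.sub (i2.add i3), ?_⟩
  refine integral_lineDeriv_eq_zero (v := Pi.single i 1)
    (integrable_continuous_mul_retEval (c := c) (δ := δ) hf.continuous hs p hK) (i1.sub (i2.add i3))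
    fun z => ?_
  have h := (hd z).mul (hasDerivAt_retEval (c := c) hδ (hf.differentiable (by simp)) p z i)
  refine h.congr_deriv ?_
  simp only [zero_smul, add_zero]
  ring

end IntegrationByParts

section PointSource

lemma integrable_and_integral_point_source :
    Integrable (fun z : V3 => 3 * (softNorm 1 z)⁻¹ ^ 5) ∧
      ∫ z : V3, 3 * (softNorm 1 z)⁻¹ ^ 5 = 4 * Real.pi := by
  let F : ℝ → ℝ := fun y => 3 * (√(y ^ 2 + 1))⁻¹ ^ 5
  have hpos : ∀ y : ℝ, 0 < y ^ 2 + 1 := fun y => by positivity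
  have hd : ∀ y : ℝ, HasDerivAt (fun y : ℝ => (y * (√(y ^ 2 + 1))⁻¹) ^ 3) (y ^ 2 * F y) y := by
    intro y
    have hs : 0 < √(y ^ 2 + 1) := Real.sqrt_pos.2 (hpos y)
    have h1 := (((hasDerivAt_pow 2 y).add_const (1 : ℝ)).sqrt (hpos y).ne').inv hs.ne'
    have h2 := ((hasDerivAt_id y).mul h1).pow 3
    refine h2.congr_deriv ?_
    have h3 : √(y ^ 2 + 1) ^ 2 = y ^ 2 + 1 := Real.sq_sqrt (hpos y).le
    simp only [F, Pi.mul_apply, Pi.inv_apply, id]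
    generalize √(y ^ 2 + 1) = s at *
    simp only [Nat.add_one_sub_one, pow_one, Nat.cast_ofNat]
    field_simp
    linear_combination y ^ 2 * h3
  have ht : Tendsto (fun y : ℝ => (y * (√(y ^ 2 + 1))⁻¹) ^ 3) atTop (𝓝 1) := by
    have h1 : Tendsto (fun y : ℝ => (√(1 + (y ^ 2)⁻¹))⁻¹ ^ 3) atTop (𝓝 ((√(1 + 0))⁻¹ ^ 3)) := by
      have : Tendsto (fun y : ℝ => (y ^ 2)⁻¹) atTop (𝓝 0) :=
        (tendsto_pow_atTop two_ne_zero).inv_tendsto_atTop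
      exact (((this.const_add 1).sqrt).inv₀ (by simp)).pow 3
    simp only [add_zero, Real.sqrt_one, inv_one, one_pow] at h1
    refine h1.congr' ?_
    filter_upwards [eventually_gt_atTop 0] with y hy
    have : y ^ 2 + 1 = y ^ 2 * (1 + (y ^ 2)⁻¹) := by field_simp
    rw [this, Real.sqrt_mul (by positivity), Real.sqrt_sq hy.le, mul_inv, ← mul_assoc,
      mul_inv_cancel₀ hy.ne', one_mul]
  have hnn : ∀ y ∈ Set.Ioi (0 : ℝ), 0 ≤ y ^ 2 * F y := fun y _ => by positivity
  have hInt := integrableOn_Ioi_deriv_of_nonneg' (a := 0) (fun y _ => hd y) hnn ht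
  have hval := integral_Ioi_of_hasDerivAt_of_nonneg' (a := 0) (fun y _ => hd y) hnn ht
  have hn : ∀ x : EuclideanSpace ℝ (Fin 3),
      3 * (softNorm 1 (WithLp.ofLp x))⁻¹ ^ 5 = F ‖x‖ := fun x => by
    have : ‖x‖ ^ 2 = ∑ i : Fin 3, x i ^ 2 := by simp [EuclideanSpace.norm_sq_eq]
    simp only [F, this, softNorm, one_pow]
  have hmp := PiLp.volume_preserving_ofLp (Fin 3)
  have hme : MeasurableEmbedding (WithLp.ofLp : EuclideanSpace ℝ (Fin 3) → V3) :=
    (MeasurableEquiv.toLp 2 V3).symm.measurableEmbedding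
  constructor
  · rw [← hmp.integrable_comp_emb hme]
    simp only [Function.comp_def, hn]
    rw [integrable_fun_norm_addHaar]
    simpa using hInt
  · rw [← hmp.integral_comp hme]
    simp only [hn]
    rw [integral_fun_norm_addHaar]
    simp only [finrank_euclideanSpace, Fintype.card_fin, smul_eq_mul, Nat.add_one_sub_one, hval]
    simp [Measure.real, EuclideanSpace.volume_ball_fin_three]
    rw [ENNReal.toReal_ofReal (by positivity)]
    ring

lemma tendsto_point_source (c : ℝ) {f : ℝ × V3 → ℝ} (hf : Continuous f)
    (hs : HasCompactSupport f) (p : ℝ × V3) :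
    Tendsto (fun δ => ∫ z, (3 * δ ^ 2 * (softNorm δ z)⁻¹ ^ 5) * retEval c δ f p z) (𝓝[>] 0)
      (𝓝 (4 * Real.pi * f p)) := by
  obtain ⟨hi, hv⟩ := integrable_and_integral_point_source
  obtain ⟨M, hM⟩ := hs.exists_bound_of_continuous hf
  have key : Tendsto (fun δ : ℝ => ∫ w : V3, (3 * (softNorm 1 w)⁻¹ ^ 5) *
      f (p.1 - δ * softNorm 1 w / c, p.2 - δ • w)) (𝓝[>] 0)
      (𝓝 (∫ w : V3, (3 * (softNorm 1 w)⁻¹ ^ 5) * f p)) := by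
    refine tendsto_integral_filter_of_dominated_convergence
      (fun w => (3 * (softNorm 1 w)⁻¹ ^ 5) * M) (Eventually.of_forall fun δ => ?_)
      (Eventually.of_forall fun δ => ae_of_all _ fun w => ?_) (hi.mul_const M)
      (ae_of_all _ fun w => ?_)
    · refine hi.aestronglyMeasurable.mul (Continuous.aestronglyMeasurable ?_)
      fun_prop
    · have := softNorm_nonneg 1 w
      rw [norm_mul, Real.norm_of_nonneg (by positivity)]
      gcongr
      exact hM _
    · refine Tendsto.const_mul _ ?_
      have : Continuous fun δ : ℝ => f (p.1 - δ * softNorm 1 w / c, p.2 - δ • w) := by fun_prop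
      simpa using (this.tendsto 0).mono_left nhdsWithin_le_nhds
  rw [integral_mul_const, hv] at key
  refine key.congr' ?_
  filter_upwards [self_mem_nhdsWithin] with δ (hδ : 0 < δ)
  have h := Measure.integral_comp_smul_of_nonneg volume
    (fun z => (3 * δ ^ 2 * (softNorm δ z)⁻¹ ^ 5) * retEval c δ f p z) δ (hR := hδ.le)
  simp only [Module.finrank_fintype_fun_eq_card, Fintype.card_fin, smul_eq_mul] at h
  rw [← mul_right_inj' (a := (δ ^ 3)⁻¹) (by positivity), ← h, ← integral_const_mul]
  congr 1 with w
  have := softNorm_pos one_ne_zero w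
  rw [retEval, softNorm_smul_self hδ.le]
  field_simp

end PointSource

section Kernels

/-- The regularised Newtonian kernel `|z|⁻¹`. -/
def kInv (δ : ℝ) (z : V3) : ℝ := (softNorm δ z)⁻¹

/-- The regularised kernel `zᵢ |z|⁻²`. -/
def kLin (i : Fin 3) (δ : ℝ) (z : V3) : ℝ := z i * (softNorm δ z)⁻¹ ^ 2

/-- The regularised kernel `zᵢ |z|⁻³`. -/
def kGrad (i : Fin 3) (δ : ℝ) (z : V3) : ℝ := z i * (softNorm δ z)⁻¹ ^ 3

lemma continuous_kInv {δ : ℝ} (hδ : δ ≠ 0) : Continuous (kInv δ) := continuous_inv_softNorm hδ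

lemma continuous_kLin (i : Fin 3) {δ : ℝ} (hδ : δ ≠ 0) : Continuous (kLin i δ) := by
  have := continuous_inv_softNorm hδ
  unfold kLin; fun_prop

lemma continuous_kGrad (i : Fin 3) {δ : ℝ} (hδ : δ ≠ 0) : Continuous (kGrad i δ) := by
  have := continuous_inv_softNorm hδ
  unfold kGrad; fun_prop

@[fun_prop]
lemma measurable_softNorm (δ : ℝ) : Measurable (softNorm δ) := (continuous_softNorm δ).measurable

lemma measurable_kInv (δ : ℝ) : Measurable (kInv δ) := by unfold kInv; fun_prop

lemma measurable_kLin (i : Fin 3) (δ : ℝ) : Measurable (kLin i δ) := by unfold kLin; fun_prop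

lemma measurable_kGrad (i : Fin 3) (δ : ℝ) : Measurable (kGrad i δ) := by unfold kGrad; fun_prop

lemma abs_coord_mul_inv_le (i : Fin 3) (δ : ℝ) (z : V3) : |z i| * (softNorm δ z)⁻¹ ≤ 1 := by
  rw [← div_eq_mul_inv]
  exact div_le_one_of_le₀ (abs_apply_le_softNorm δ z i) (softNorm_nonneg δ z)

lemma sum_sq_mul_inv_sq_le (δ : ℝ) (z : V3) :
    (∑ i : Fin 3, z i ^ 2) * (softNorm δ z)⁻¹ ^ 2 ≤ 1 := by
  rw [inv_pow, ← div_eq_mul_inv]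
  refine div_le_one_of_le₀ ?_ (sq_nonneg _)
  rw [softNorm_sq]; nlinarith [sq_nonneg δ]

lemma sq_mul_inv_sq_le (δ : ℝ) (z : V3) : δ ^ 2 * (softNorm δ z)⁻¹ ^ 2 ≤ 1 := by
  rw [inv_pow, ← div_eq_mul_inv]
  refine div_le_one_of_le₀ ?_ (sq_nonneg _)
  rw [softNorm_sq]
  have := Finset.sum_nonneg fun (i : Fin 3) (_ : i ∈ Finset.univ) => sq_nonneg (z i)
  linarith

lemma abs_kInv_le (δ : ℝ) (z : V3) (hz : z ≠ 0) : |kInv δ z| ≤ 1 * singBound z := by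
  rw [kInv, abs_of_nonneg (inv_nonneg.2 (softNorm_nonneg δ z)), one_mul]
  exact inv_softNorm_le hz δ

lemma abs_kLin_le (i : Fin 3) (δ : ℝ) (z : V3) (hz : z ≠ 0) :
    |kLin i δ z| ≤ 1 * singBound z := by
  have hu := inv_nonneg.2 (softNorm_nonneg δ z)
  have h := inv_softNorm_le hz δ
  have h2 := abs_coord_mul_inv_le i δ z
  rw [kLin, abs_mul, abs_of_nonneg (pow_nonneg hu 2), one_mul]
  nlinarith

lemma abs_kGrad_le (i : Fin 3) (δ : ℝ) (z : V3) (hz : z ≠ 0) :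
    |kGrad i δ z| ≤ 1 * singBound z := by
  have hu := inv_nonneg.2 (softNorm_nonneg δ z)
  have h := inv_softNorm_sq_le hz δ
  rw [← inv_pow] at h
  have h2 := abs_coord_mul_inv_le i δ z
  rw [kGrad, abs_mul, abs_of_nonneg (pow_nonneg hu 3), one_mul]
  nlinarith [pow_nonneg hu 2]

lemma continuousAt_inv_softNorm {z : V3} (hz : z ≠ 0) :
    ContinuousAt (fun δ => (softNorm δ z)⁻¹) 0 :=
  (continuous_softNorm_left z).continuousAt.inv₀ (softNorm_pos_of_ne hz 0).ne'

lemma hasDerivAt_inv_softNorm {δ : ℝ} (hδ : δ ≠ 0) (z : V3) (i : Fin 3) :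
    HasDerivAt (fun τ : ℝ => (softNorm δ (z + τ • Pi.single i (1 : ℝ)))⁻¹)
      (-(z i * (softNorm δ z)⁻¹ ^ 3)) 0 := by
  have hs := softNorm_pos hδ z
  refine ((hasDerivAt_softNorm hδ z i).inv (by simpa using hs.ne')).congr_deriv ?_
  simp only [zero_smul, add_zero]
  field_simp

lemma hasDerivAt_kLin {δ : ℝ} (hδ : δ ≠ 0) (z : V3) (i : Fin 3) :
    HasDerivAt (fun τ : ℝ => kLin i δ (z + τ • Pi.single i (1 : ℝ)))
      ((softNorm δ z)⁻¹ ^ 2 - 2 * z i ^ 2 * (softNorm δ z)⁻¹ ^ 4) 0 := by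
  refine ((hasDerivAt_coord z i).mul ((hasDerivAt_inv_softNorm hδ z i).pow 2)).congr_deriv ?_
  simp
  ring

lemma hasDerivAt_kGrad {δ : ℝ} (hδ : δ ≠ 0) (z : V3) (i : Fin 3) :
    HasDerivAt (fun τ : ℝ => kGrad i δ (z + τ • Pi.single i (1 : ℝ)))
      ((softNorm δ z)⁻¹ ^ 3 - 3 * z i ^ 2 * (softNorm δ z)⁻¹ ^ 5) 0 := by
  refine ((hasDerivAt_coord z i).mul ((hasDerivAt_inv_softNorm hδ z i).pow 3)).congr_deriv ?_
  simp
  ring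

end Kernels

section Potentials

lemma dirDeriv_comm {f : ℝ × V3 → ℝ} (hf : ContDiff ℝ ∞ f) (v w : ℝ × V3) :
    dirDeriv v (dirDeriv w f) = dirDeriv w (dirDeriv v f) := by
  ext p
  have hd : DifferentiableAt ℝ (fderiv ℝ f) p :=
    (hf.fderiv_right (m := ∞) (by simp)).differentiable (by simp) p
  have key : ∀ u u', dirDeriv u (dirDeriv u' f) p = fderiv ℝ (fderiv ℝ f) p u u' := fun u u' => by
    change fderiv ℝ (fun q => fderiv ℝ f q u') p u = _
    rw [fderiv_clm_apply hd (differentiableAt_const _)]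
    simp
  rw [key, key]
  exact hf.contDiffAt.isSymmSndFDerivAt (by simp; norm_cast) v w

lemma tendsto_zero_unique {F : ℝ → ℝ} {a : ℝ} (hF : ∀ δ > 0, F δ = 0)
    (h : Tendsto F (𝓝[>] 0) (𝓝 a)) : a = 0 := by
  refine tendsto_nhds_unique h (tendsto_const_nhds.congr' ?_)
  filter_upwards [self_mem_nhdsWithin] with δ hδ using (hF δ hδ).symm

variable {c : ℝ} {f : ℝ × V3 → ℝ}

lemma parts_kInv {δ : ℝ} (hδ : δ ≠ 0) (hf : ContDiff ℝ ∞ f) (hs : HasCompactSupport f)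
    (p : ℝ × V3) (i : Fin 3) :
    HasIntegralEq (fun z => -kGrad i δ z * retEval c δ f p z -
      (kInv δ z * retEval c δ (dirDeriv (eSpace i) f) p z +
        (z i * (softNorm δ z)⁻¹ * c⁻¹ * kInv δ z) * retEval c δ (dirDeriv eTime f) p z)) 0 :=
  integral_parts_retEval hδ hf hs p i (continuous_kInv hδ) (continuous_kGrad i hδ).neg
    fun z => hasDerivAt_inv_softNorm hδ z i

lemma parts_kLin {δ : ℝ} (hδ : δ ≠ 0) (hf : ContDiff ℝ ∞ f) (hs : HasCompactSupport f)
    (p : ℝ × V3) (i : Fin 3) :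
    HasIntegralEq (fun z =>
      ((softNorm δ z)⁻¹ ^ 2 - 2 * z i ^ 2 * (softNorm δ z)⁻¹ ^ 4) * retEval c δ f p z -
      (kLin i δ z * retEval c δ (dirDeriv (eSpace i) f) p z +
        (z i * (softNorm δ z)⁻¹ * c⁻¹ * kLin i δ z) * retEval c δ (dirDeriv eTime f) p z)) 0 := by
  have := continuous_inv_softNorm hδ
  exact integral_parts_retEval hδ hf hs p i (continuous_kLin i hδ) (by fun_prop)
    fun z => hasDerivAt_kLin hδ z i

lemma parts_kGrad {δ : ℝ} (hδ : δ ≠ 0) (hf : ContDiff ℝ ∞ f) (hs : HasCompactSupport f)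
    (p : ℝ × V3) (i : Fin 3) :
    HasIntegralEq (fun z =>
      ((softNorm δ z)⁻¹ ^ 3 - 3 * z i ^ 2 * (softNorm δ z)⁻¹ ^ 5) * retEval c δ f p z -
      (kGrad i δ z * retEval c δ (dirDeriv (eSpace i) f) p z +
        (z i * (softNorm δ z)⁻¹ * c⁻¹ * kGrad i δ z) * retEval c δ (dirDeriv eTime f) p z)) 0 := by
  have := continuous_inv_softNorm hδ
  exact integral_parts_retEval hδ hf hs p i (continuous_kGrad i hδ) (by fun_prop)
    fun z => hasDerivAt_kGrad hδ z i

/-- The gradient of the retarded potential, with the derivative moved onto the kernel. -/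
lemma retPot_kInv_dirDeriv_eSpace (hf : ContDiff ℝ ∞ f) (hs : HasCompactSupport f)
    (p : ℝ × V3) (i : Fin 3) :
    retPot c (kInv 0) (dirDeriv (eSpace i) f) p =
      -retPot c (kGrad i 0) f p - c⁻¹ * retPot c (kLin i 0) (dirDeriv eTime f) p := by
  have hfi := dirDeriv_contDiff hf (eSpace i)
  have hft := dirDeriv_contDiff hf eTime
  have hsi := dirDeriv_hasCompactSupport hs (eSpace i)
  have hst := dirDeriv_hasCompactSupport hs eTime
  have t1 := tendsto_integral_retEval (c := c) hf.continuous hs p (measurable_kGrad i)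
    (abs_kGrad_le i) fun z hz => continuousAt_const.mul ((continuousAt_inv_softNorm hz).pow 3)
  have t2 := tendsto_integral_retEval (c := c) hfi.continuous hsi p measurable_kInv abs_kInv_le
    fun z hz => continuousAt_inv_softNorm hz
  have t3 := tendsto_integral_retEval (c := c) hft.continuous hst p (measurable_kLin i)
    (abs_kLin_le i) fun z hz => continuousAt_const.mul ((continuousAt_inv_softNorm hz).pow 2)
  have := tendsto_zero_unique (fun δ hδ => ?_) ((t1.neg.sub t2).sub (t3.const_mul c⁻¹))
  · linarith
  · have hδ' : δ ≠ 0 := (ne_of_gt hδ)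
    have i1 := integrable_continuous_mul_retEval (c := c) (δ := δ) hf.continuous hs p
      (continuous_kGrad i hδ')
    have i2 := integrable_continuous_mul_retEval (c := c) (δ := δ) hfi.continuous hsi p
      (continuous_kInv hδ')
    have i3 := integrable_continuous_mul_retEval (c := c) (δ := δ) hft.continuous hst p
      (continuous_kLin i hδ')
    refine (((hasIntegralEq_integral i1).neg.sub (hasIntegralEq_integral i2)).sub
      ((hasIntegralEq_integral i3).const_mul c⁻¹)).unique
      (parts_kInv (c := c) hδ' hf hs p i) fun z => ?_
    simp only [kInv, kLin]
    ring

/-- The retarded potential solves the inhomogeneous wave equation. -/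
lemma retPot_kInv_wave (hf : ContDiff ℝ ∞ f) (hs : HasCompactSupport f) (p : ℝ × V3) :
    ∑ i : Fin 3, retPot c (kInv 0) (dirDeriv (eSpace i) (dirDeriv (eSpace i) f)) p
      - (c⁻¹) ^ 2 * retPot c (kInv 0) (dirDeriv eTime (dirDeriv eTime f)) p
      = -(4 * Real.pi * f p) := by
  have hfi := fun i => dirDeriv_contDiff hf (eSpace i)
  have hft := dirDeriv_contDiff hf eTime
  have hsi := fun i => dirDeriv_hasCompactSupport hs (eSpace i)
  have hst := dirDeriv_hasCompactSupport hs eTime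
  have hfii := fun i => dirDeriv_contDiff (hfi i) (eSpace i)
  have hsii := fun i => dirDeriv_hasCompactSupport (hsi i) (eSpace i)
  have hftt := dirDeriv_contDiff hft eTime
  have hstt := dirDeriv_hasCompactSupport hst eTime
  have t1 := fun i => tendsto_integral_retEval (c := c) (hfii i).continuous (hsii i) p
    measurable_kInv abs_kInv_le fun z hz => continuousAt_inv_softNorm hz
  have t2 := tendsto_integral_retEval (c := c) hftt.continuous hstt p (C := 1)
    (K := fun δ z => (∑ i : Fin 3, z i ^ 2) * (softNorm δ z)⁻¹ ^ 3) (fun δ => by fun_prop)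
    (fun δ z hz => by
      have hu := inv_nonneg.2 (softNorm_nonneg δ z)
      have hr := Finset.sum_nonneg fun (i : Fin 3) (_ : i ∈ Finset.univ) => sq_nonneg (z i)
      rw [abs_of_nonneg (by positivity)]
      nlinarith [inv_softNorm_le hz δ, sum_sq_mul_inv_sq_le δ z])
    fun z hz => continuousAt_const.mul ((continuousAt_inv_softNorm hz).pow 3)
  have t3 := tendsto_integral_retEval (c := c) hft.continuous hst p (C := 3)
    (K := fun δ z => 3 * δ ^ 2 * (softNorm δ z)⁻¹ ^ 4) (fun δ => by fun_prop)
    (fun δ z hz => by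
      have h := inv_softNorm_sq_le hz δ
      rw [← inv_pow] at h
      rw [abs_of_nonneg (by positivity)]
      nlinarith [sq_mul_inv_sq_le δ z, sq_nonneg (softNorm δ z)⁻¹])
    fun z hz => ContinuousAt.mul (by fun_prop) ((continuousAt_inv_softNorm hz).pow 4)
  have t4 := tendsto_point_source c hf.continuous hs p
  have h2 : retPot c (fun z => (∑ i : Fin 3, z i ^ 2) * (softNorm 0 z)⁻¹ ^ 3) =
      retPot c (kInv 0) := by
    congr 1 with z
    rw [kInv, ← norm3_sq, ← softNorm_zero]
    rcases eq_or_ne (softNorm 0 z) 0 with h | h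
    · simp [h]
    · field_simp
  have h3 : retPot c (fun z => 3 * 0 ^ 2 * (softNorm 0 z)⁻¹ ^ 4) (dirDeriv eTime f) p = 0 := by
    simp [retPot]
  rw [h2] at t2
  rw [h3] at t3
  have := tendsto_zero_unique (fun δ hδ => ?_)
    ((((tendsto_finsetSum Finset.univ fun i _ => t1 i).neg.add
      (t2.const_mul (c⁻¹ ^ 2))).sub (t3.const_mul c⁻¹)).sub t4)
  · linarith
  · have hδ' : δ ≠ 0 := (ne_of_gt hδ)
    have hu := continuous_inv_softNorm hδ'
    have i1 := fun i => integrable_continuous_mul_retEval (c := c) (δ := δ) (hfii i).continuous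
      (hsii i) p (continuous_kInv hδ')
    have i2 := integrable_continuous_mul_retEval (c := c) (δ := δ) hftt.continuous hstt p
      (K := fun z => (∑ i : Fin 3, z i ^ 2) * (softNorm δ z)⁻¹ ^ 3) (by fun_prop)
    have i3 := integrable_continuous_mul_retEval (c := c) (δ := δ) hft.continuous hst p
      (K := fun z => 3 * δ ^ 2 * (softNorm δ z)⁻¹ ^ 4) (by fun_prop)
    have i4 := integrable_continuous_mul_retEval (c := c) (δ := δ) hf.continuous hs p
      (K := fun z => 3 * δ ^ 2 * (softNorm δ z)⁻¹ ^ 5) (by fun_prop)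
    have hL := (((HasIntegralEq.sum fun i => hasIntegralEq_integral (i1 i)).neg.add
      ((hasIntegralEq_integral i2).const_mul (c⁻¹ ^ 2))).sub
        ((hasIntegralEq_integral i3).const_mul c⁻¹)).sub (hasIntegralEq_integral i4)
    have hR := HasIntegralEq.sum fun i =>
      ((parts_kInv (c := c) hδ' (hfi i) (hsi i) p i).sub
        ((parts_kLin (c := c) hδ' hft hst p i).const_mul c⁻¹)).sub
        (parts_kGrad (c := c) hδ' hf hs p i)
    refine (hL.unique hR fun z => ?_).trans (by simp)
    have hs2 := softNorm_sq δ z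
    have hpos := (softNorm_pos hδ' z).ne'
    simp only [kInv, kLin, kGrad, dirDeriv_comm hf eTime, Fin.sum_univ_three] at hs2 ⊢
    have hδs : δ ^ 2 = ((softNorm δ z)⁻¹ ^ 2)⁻¹ - (z 0 ^ 2 + z 1 ^ 2 + z 2 ^ 2) := by
      rw [inv_pow, inv_inv]; linarith
    generalize softNorm δ z = s at *
    rw [hδs]
    field_simp
    ring

end Potentials

section Fields

variable {f : ℝ × V3 → ℝ}

lemma pxd_eq_dirDeriv (hf : Differentiable ℝ f) (i : Fin 3) : pxd i f = dirDeriv (eSpace i) f := by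
  ext p
  have h : HasFDerivAt (fun y : V3 => ((p.1, y) : ℝ × V3)) (ContinuousLinearMap.inr ℝ ℝ V3) p.2 :=
    (hasFDerivAt_const p.1 p.2).prodMk (hasFDerivAt_id p.2)
  have h2 : HasFDerivAt (fun y : V3 => f (p.1, y)) _ p.2 := (hf p).hasFDerivAt.comp p.2 h
  rw [pxd, h2.fderiv]
  simp [dirDeriv, eSpace]

lemma ptd_eq_dirDeriv (hf : Differentiable ℝ f) : ptd f = dirDeriv eTime f := by
  ext p
  have h : HasDerivAt (fun s : ℝ => ((s, p.2) : ℝ × V3)) (1, 0) p.1 :=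
    (hasDerivAt_id p.1).prodMk (hasDerivAt_const p.1 p.2)
  exact ((hf p).hasFDerivAt.comp_hasDerivAt p.1 h).deriv

lemma ptd_apply_eq_dirDeriv {F : ℝ × V3 → V3} (hF : Differentiable ℝ F) (p : ℝ × V3) (i : Fin 3) :
    ptd F p i = dirDeriv eTime (fun q => F q i) p := by
  have hd : DifferentiableAt ℝ (fun s => F (s, p.2)) p.1 :=
    (hF (p.1, p.2)).comp p.1 (by fun_prop : DifferentiableAt ℝ (fun s : ℝ => (s, p.2)) p.1)
  rw [← ptd_eq_dirDeriv (differentiable_pi.1 hF i), ptd, ptd, deriv_pi (differentiableAt_pi.1 hd)]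

lemma hasCompactSupport_apply {F : ℝ × V3 → V3} (hF : HasCompactSupport F) (i : Fin 3) :
    HasCompactSupport fun q => F q i :=
  hF.comp_left (g := fun v : V3 => v i) rfl

lemma contDiff_retPot_kInv_comb {c : ℝ} {g : ℝ × V3 → ℝ} (hf : ContDiff ℝ ∞ f)
    (hfs : HasCompactSupport f) (hg : ContDiff ℝ ∞ g) (hgs : HasCompactSupport g) (a b : ℝ) :
    ContDiff ℝ ∞ fun q => a * retPot c (kInv 0) f q + b * retPot c (kInv 0) g q :=
  (contDiff_const.mul (contDiff_retPot (measurable_kInv 0) (abs_kInv_le 0) hf hfs)).add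
    (contDiff_const.mul (contDiff_retPot (measurable_kInv 0) (abs_kInv_le 0) hg hgs))

lemma dirDeriv_retPot_kInv_comb {c : ℝ} {g : ℝ × V3 → ℝ} (hf : ContDiff ℝ ∞ f)
    (hfs : HasCompactSupport f) (hg : ContDiff ℝ ∞ g) (hgs : HasCompactSupport g) (a b : ℝ)
    (v p : ℝ × V3) :
    dirDeriv v (fun q => a * retPot c (kInv 0) f q + b * retPot c (kInv 0) g q) p =
      a * retPot c (kInv 0) (dirDeriv v f) p + b * retPot c (kInv 0) (dirDeriv v g) p := by
  have hF := (contDiff_retPot (c := c) (measurable_kInv 0) (abs_kInv_le 0) hf hfs).differentiable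
    (by simp) p
  have hG := (contDiff_retPot (c := c) (measurable_kInv 0) (abs_kInv_le 0) hg hgs).differentiable
    (by simp) p
  rw [← dirDeriv_retPot (measurable_kInv 0) (abs_kInv_le 0) hf hfs,
    ← dirDeriv_retPot (measurable_kInv 0) (abs_kInv_le 0) hg hgs, dirDeriv,
    fderiv_fun_add (hF.const_mul a) (hG.const_mul b), fderiv_const_mul hF, fderiv_const_mul hG]
  rfl

variable {c : ℝ} {ρ : ℝ × V3 → ℝ} {J : ℝ × V3 → V3}

/-- The electric Jefimenko integral in terms of retarded potentials. -/
lemma integral_electric (hρ : ContDiff ℝ ∞ ρ) (hρs : HasCompactSupport ρ) (hJ : ContDiff ℝ ∞ J)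
    (hJs : HasCompactSupport J) (p : ℝ × V3) (i : Fin 3) :
    (∫ y : V3,
        ((ρ (p.1 - norm3 (p.2 - y) / c, y) / norm3 (p.2 - y) ^ 2) •
            ((norm3 (p.2 - y))⁻¹ • (p.2 - y)) +
          (ptd ρ (p.1 - norm3 (p.2 - y) / c, y) / (c * norm3 (p.2 - y))) •
            ((norm3 (p.2 - y))⁻¹ • (p.2 - y)) -
          (c ^ 2 * norm3 (p.2 - y))⁻¹ • ptd J (p.1 - norm3 (p.2 - y) / c, y))) i =
      -retPot c (kInv 0) (dirDeriv (eSpace i) ρ) p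
        - c⁻¹ ^ 2 * retPot c (kInv 0) (dirDeriv eTime fun q => J q i) p := by
  have hJc := fun j => contDiff_pi.1 hJ j
  have hJcs := fun j => hasCompactSupport_apply hJs j
  have h := fun j =>
    ((hasIntegralEq_integral (integrable_mul_retEval (c := c) hρ.continuous hρs p
      (measurable_kGrad j 0) (abs_kGrad_le j 0))).add
    ((hasIntegralEq_integral (integrable_mul_retEval (c := c)
      (dirDeriv_contDiff hρ eTime).continuous (dirDeriv_hasCompactSupport hρs eTime) p
      (measurable_kLin j 0) (abs_kLin_le j 0))).const_mul c⁻¹)).sub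
    ((hasIntegralEq_integral (integrable_mul_retEval (c := c)
      (dirDeriv_contDiff (hJc j) eTime).continuous (dirDeriv_hasCompactSupport (hJcs j) eTime) p
      (measurable_kInv 0) (abs_kInv_le 0))).const_mul (c⁻¹ ^ 2))
  have hG : ∀ z j, (fun y : V3 =>
        (ρ (p.1 - norm3 (p.2 - y) / c, y) / norm3 (p.2 - y) ^ 2) •
            ((norm3 (p.2 - y))⁻¹ • (p.2 - y)) +
          (ptd ρ (p.1 - norm3 (p.2 - y) / c, y) / (c * norm3 (p.2 - y))) •
            ((norm3 (p.2 - y))⁻¹ • (p.2 - y)) -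
          (c ^ 2 * norm3 (p.2 - y))⁻¹ • ptd J (p.1 - norm3 (p.2 - y) / c, y)) (p.2 - z) j =
      kGrad j 0 z * retEval c 0 ρ p z + c⁻¹ * (kLin j 0 z * retEval c 0 (dirDeriv eTime ρ) p z)
        - c⁻¹ ^ 2 * (kInv 0 z * retEval c 0 (dirDeriv eTime fun q => J q j) p z) := by
    intro z j
    simp only [sub_sub_cancel, Pi.add_apply, Pi.sub_apply, Pi.smul_apply, smul_eq_mul,
      ptd_apply_eq_dirDeriv (hJ.differentiable (by simp)),
      ptd_eq_dirDeriv (hρ.differentiable (by simp)), kGrad, kLin, kInv, retEval, softNorm_zero,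
      mul_inv, div_eq_mul_inv]
    ring
  rw [← integral_sub_left_eq_self _ volume p.2, eval_integral, funext fun z => hG z i, (h i).2,
    retPot_kInv_dirDeriv_eSpace hρ hρs]
  · simp only [retPot]
    ring
  · intro j
    rw [funext fun z => hG z j]
    exact (h j).1

/-- The contribution of the `i`-th current component and `j`-th displacement component to the
magnetic Jefimenko integral. -/
lemma hasIntegralEq_magnetic (hJ : ContDiff ℝ ∞ J) (hJs : HasCompactSupport J) (p : ℝ × V3)
    (i j : Fin 3) :
    HasIntegralEq (fun z => kGrad j 0 z * retEval c 0 (fun q => J q i) p z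
        + c⁻¹ * (kLin j 0 z * retEval c 0 (dirDeriv eTime fun q => J q i) p z))
      (-retPot c (kInv 0) (dirDeriv (eSpace j) fun q => J q i) p) := by
  have hJc := contDiff_pi.1 hJ i
  have hJcs := hasCompactSupport_apply hJs i
  have h := (hasIntegralEq_integral (integrable_mul_retEval (c := c) hJc.continuous hJcs p
      (measurable_kGrad j 0) (abs_kGrad_le j 0))).add
    ((hasIntegralEq_integral (integrable_mul_retEval (c := c)
      (dirDeriv_contDiff hJc eTime).continuous (dirDeriv_hasCompactSupport hJcs eTime) p
      (measurable_kLin j 0) (abs_kLin_le j 0))).const_mul c⁻¹)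
  convert h using 1
  rw [retPot_kInv_dirDeriv_eSpace hJc hJcs]
  simp only [retPot]
  ring

/-- The magnetic Jefimenko integral is the curl of the retarded potential. -/
lemma integral_magnetic (hJ : ContDiff ℝ ∞ J) (hJs : HasCompactSupport J) (p : ℝ × V3) :
    ∫ y : V3,
        cross3
          ((norm3 (p.2 - y) ^ 2)⁻¹ • J (p.1 - norm3 (p.2 - y) / c, y) +
            (c * norm3 (p.2 - y))⁻¹ • ptd J (p.1 - norm3 (p.2 - y) / c, y))
          ((norm3 (p.2 - y))⁻¹ • (p.2 - y)) =
      ![retPot c (kInv 0) (dirDeriv (eSpace 1) fun q => J q 2) p -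
          retPot c (kInv 0) (dirDeriv (eSpace 2) fun q => J q 1) p,
        retPot c (kInv 0) (dirDeriv (eSpace 2) fun q => J q 0) p -
          retPot c (kInv 0) (dirDeriv (eSpace 0) fun q => J q 2) p,
        retPot c (kInv 0) (dirDeriv (eSpace 0) fun q => J q 1) p -
          retPot c (kInv 0) (dirDeriv (eSpace 1) fun q => J q 0) p] := by
  have h := fun i j => hasIntegralEq_magnetic (c := c) hJ hJs p i j
  rw [← integral_sub_left_eq_self _ volume p.2]
  simp only [sub_sub_cancel]
  have key : ∀ k i j, (∀ a b : V3, cross3 a b k = a i * b j - a j * b i) →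
      HasIntegralEq (fun z => cross3
          ((norm3 z ^ 2)⁻¹ • J (p.1 - norm3 z / c, p.2 - z) +
            (c * norm3 z)⁻¹ • ptd J (p.1 - norm3 z / c, p.2 - z)) ((norm3 z)⁻¹ • z) k)
        (retPot c (kInv 0) (dirDeriv (eSpace i) fun q => J q j) p -
          retPot c (kInv 0) (dirDeriv (eSpace j) fun q => J q i) p) := by
    intro k i j hk
    convert (h i j).sub (h j i) using 1
    · ext z
      simp only [hk, Pi.add_apply, Pi.smul_apply, smul_eq_mul,
        ptd_apply_eq_dirDeriv (hJ.differentiable (by simp)), kGrad, kLin, retEval, softNorm_zero,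
        mul_inv]
      ring
    · ring
  have h0 := key 0 1 2 fun a b => rfl
  have h1 := key 1 2 0 fun a b => rfl
  have h2 := key 2 0 1 fun a b => rfl
  ext k
  rw [eval_integral fun k => by fin_cases k <;> [exact h0.1; exact h1.1; exact h2.1]]
  fin_cases k
  · exact h0.2
  · exact h1.2
  · exact h2.2

/-- The continuity equation for the retarded potentials. -/
lemma retPot_kInv_continuity (hρ : ContDiff ℝ ∞ ρ) (hρs : HasCompactSupport ρ)
    (hJ : ContDiff ℝ ∞ J) (hJs : HasCompactSupport J) (hcont : ∀ q, ptd ρ q + divg J q = 0)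
    (v p : ℝ × V3) :
    retPot c (kInv 0) (dirDeriv v (dirDeriv eTime ρ)) p +
      ∑ i : Fin 3, retPot c (kInv 0) (dirDeriv v (dirDeriv (eSpace i) fun q => J q i)) p = 0 := by
  have hJc := fun i => contDiff_pi.1 hJ i
  have hJcs := fun i => hasCompactSupport_apply hJs i
  have hρt := dirDeriv_contDiff hρ eTime
  have hJi := fun i => dirDeriv_contDiff (hJc i) (eSpace i)
  have hI : ∀ {g : ℝ × V3 → ℝ}, ContDiff ℝ ∞ g → HasCompactSupport g →
      HasIntegralEq (fun z => kInv 0 z * retEval c 0 (dirDeriv v g) p z)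
        (retPot c (kInv 0) (dirDeriv v g) p) := fun hg hgs =>
    hasIntegralEq_integral (integrable_mul_retEval (dirDeriv_contDiff hg v).continuous
      (dirDeriv_hasCompactSupport hgs v) p (measurable_kInv 0) (abs_kInv_le 0))
  have hzero : (fun q => dirDeriv eTime ρ q + ∑ i, dirDeriv (eSpace i) (fun q => J q i) q) = 0 := by
    ext q
    rw [← ptd_eq_dirDeriv (hρ.differentiable (by simp))]
    simp only [← pxd_eq_dirDeriv ((hJc _).differentiable (by simp))]
    exact hcont q
  have hd : ∀ q, dirDeriv v (dirDeriv eTime ρ) q +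
      ∑ i, dirDeriv v (dirDeriv (eSpace i) fun q => J q i) q = 0 := by
    intro q
    have h1 := (hρt.differentiable (by simp) q).hasFDerivAt.add
      (HasFDerivAt.fun_sum (u := Finset.univ) fun i _ =>
        ((hJi i).differentiable (by simp) q).hasFDerivAt)
    have h2 := h1.unique ((hasFDerivAt_const (0 : ℝ) q).congr_of_eventuallyEq
      (Eventually.of_forall fun q' => congr_fun hzero q'))
    simpa [dirDeriv] using DFunLike.congr_fun h2 v
  refine ((hI hρt (dirDeriv_hasCompactSupport hρs eTime)).add (HasIntegralEq.sum fun i =>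
    hI (hJi i) (dirDeriv_hasCompactSupport (hJcs i) (eSpace i)))).2.symm.trans ?_
  simp only [← Finset.mul_sum, ← mul_add, retEval, hd, mul_zero, integral_zero]

end Fields

/-- the Jefimenko fields of a compactly supported charge/current
pair satisfying the continuity equation are smooth and satisfy Maxwell's
equations. -/
theorem stmt_3 (ε₀ μ₀ c : ℝ) (hε : 0 < ε₀) (hμ : 0 < μ₀)
    (hc : c = 1 / Real.sqrt (μ₀ * ε₀))
    (ρ : ℝ × V3 → ℝ) (J : ℝ × V3 → V3)
    (hρ : ContDiff ℝ (⊤ : ℕ∞) ρ) (hJ : ContDiff ℝ (⊤ : ℕ∞) J)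
    (hρsupp : HasCompactSupport ρ) (hJsupp : HasCompactSupport J)
    (hcont : ∀ p : ℝ × V3, ptd ρ p + divg J p = 0)
    (E B : ℝ × V3 → V3)
    (hE : E = fun p => (1 / (4 * Real.pi * ε₀)) •
      ∫ y : V3,
        ((ρ (p.1 - norm3 (p.2 - y) / c, y) / norm3 (p.2 - y) ^ 2) •
            ((norm3 (p.2 - y))⁻¹ • (p.2 - y)) +
          (ptd ρ (p.1 - norm3 (p.2 - y) / c, y) / (c * norm3 (p.2 - y))) •
            ((norm3 (p.2 - y))⁻¹ • (p.2 - y)) -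
          (c ^ 2 * norm3 (p.2 - y))⁻¹ • ptd J (p.1 - norm3 (p.2 - y) / c, y)))
    (hB : B = fun p => (μ₀ / (4 * Real.pi)) •
      ∫ y : V3,
        cross3
          ((norm3 (p.2 - y) ^ 2)⁻¹ • J (p.1 - norm3 (p.2 - y) / c, y) +
            (c * norm3 (p.2 - y))⁻¹ • ptd J (p.1 - norm3 (p.2 - y) / c, y))
          ((norm3 (p.2 - y))⁻¹ • (p.2 - y))) :
    ContDiff ℝ (⊤ : ℕ∞) E ∧ ContDiff ℝ (⊤ : ℕ∞) B ∧ Maxwell ε₀ μ₀ ρ J E B := by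
  have hμε : 0 < μ₀ * ε₀ := mul_pos hμ hε
  have hc2 : c⁻¹ ^ 2 = μ₀ * ε₀ := by
    rw [hc, one_div, inv_inv, Real.sq_sqrt hμε.le]
  have hJc := fun i => contDiff_pi.1 hJ i
  have hJcs := fun i => hasCompactSupport_apply hJsupp i
  have hρi := fun i => dirDeriv_contDiff hρ (eSpace i)
  have hρis := fun i => dirDeriv_hasCompactSupport hρsupp (eSpace i)
  have hJt := fun i => dirDeriv_contDiff (hJc i) eTime
  have hJts := fun i => dirDeriv_hasCompactSupport (hJcs i) eTime
  have hJi := fun i j => dirDeriv_contDiff (hJc j) (eSpace i)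
  have hJis := fun i j => dirDeriv_hasCompactSupport (hJcs j) (eSpace i)
  have hEi : ∀ i, (fun p => E p i) = fun p =>
      -(1 / (4 * Real.pi * ε₀)) * retPot c (kInv 0) (dirDeriv (eSpace i) ρ) p +
        -(μ₀ / (4 * Real.pi)) * retPot c (kInv 0) (dirDeriv eTime fun q => J q i) p := by
    intro i
    ext p
    simp only [hE, Pi.smul_apply, integral_electric hρ hρsupp hJ hJsupp, hc2, smul_eq_mul]
    field_simp
    ring
  have hB0 : (fun p => B p 0) = fun p =>
      μ₀ / (4 * Real.pi) * retPot c (kInv 0) (dirDeriv (eSpace 1) fun q => J q 2) p +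
        -(μ₀ / (4 * Real.pi)) * retPot c (kInv 0) (dirDeriv (eSpace 2) fun q => J q 1) p := by
    ext p
    simp only [hB, integral_magnetic hJ hJsupp, Pi.smul_apply, smul_eq_mul, Matrix.cons_val]
    ring
  have hB1 : (fun p => B p 1) = fun p =>
      μ₀ / (4 * Real.pi) * retPot c (kInv 0) (dirDeriv (eSpace 2) fun q => J q 0) p +
        -(μ₀ / (4 * Real.pi)) * retPot c (kInv 0) (dirDeriv (eSpace 0) fun q => J q 2) p := by
    ext p
    simp only [hB, integral_magnetic hJ hJsupp, Pi.smul_apply, smul_eq_mul, Matrix.cons_val]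
    ring
  have hB2 : (fun p => B p 2) = fun p =>
      μ₀ / (4 * Real.pi) * retPot c (kInv 0) (dirDeriv (eSpace 0) fun q => J q 1) p +
        -(μ₀ / (4 * Real.pi)) * retPot c (kInv 0) (dirDeriv (eSpace 1) fun q => J q 0) p := by
    ext p
    simp only [hB, integral_magnetic hJ hJsupp, Pi.smul_apply, smul_eq_mul, Matrix.cons_val]
    ring
  clear hE hB
  have hEs : ∀ i, ContDiff ℝ ∞ fun p => E p i := fun i =>
    hEi i ▸ contDiff_retPot_kInv_comb (hρi i) (hρis i) (hJt i) (hJts i) _ _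
  have hBs : ∀ i, ContDiff ℝ ∞ fun p => B p i := by
    intro i
    fin_cases i
    · exact hB0 ▸ contDiff_retPot_kInv_comb (hJi 1 2) (hJis 1 2) (hJi 2 1) (hJis 2 1) _ _
    · exact hB1 ▸ contDiff_retPot_kInv_comb (hJi 2 0) (hJis 2 0) (hJi 0 2) (hJis 0 2) _ _
    · exact hB2 ▸ contDiff_retPot_kInv_comb (hJi 0 1) (hJis 0 1) (hJi 1 0) (hJis 1 0) _ _
  have hE : ContDiff ℝ ∞ E := contDiff_pi.2 hEs
  have hB : ContDiff ℝ ∞ B := contDiff_pi.2 hBs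
  refine ⟨hE, hB, fun p => ?_⟩
  have dE : ∀ v i, dirDeriv v (fun q => E q i) p = _ := fun v i =>
    hEi i ▸ dirDeriv_retPot_kInv_comb (hρi i) (hρis i) (hJt i) (hJts i) _ _ v p
  have dB0 : ∀ v, dirDeriv v (fun q => B q 0) p = _ := fun v =>
    hB0 ▸ dirDeriv_retPot_kInv_comb (hJi 1 2) (hJis 1 2) (hJi 2 1) (hJis 2 1) _ _ v p
  have dB1 : ∀ v, dirDeriv v (fun q => B q 1) p = _ := fun v =>
    hB1 ▸ dirDeriv_retPot_kInv_comb (hJi 2 0) (hJis 2 0) (hJi 0 2) (hJis 0 2) _ _ v p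
  have dB2 : ∀ v, dirDeriv v (fun q => B q 2) p = _ := fun v =>
    hB2 ▸ dirDeriv_retPot_kInv_comb (hJi 0 1) (hJis 0 1) (hJi 1 0) (hJis 1 0) _ _ v p
  have pE : ∀ j i, pxd j (fun q => E q i) p = dirDeriv (eSpace j) (fun q => E q i) p :=
    fun j i => by rw [pxd_eq_dirDeriv ((hEs i).differentiable (by simp))]
  have pB : ∀ j i, pxd j (fun q => B q i) p = dirDeriv (eSpace j) (fun q => B q i) p :=
    fun j i => by rw [pxd_eq_dirDeriv ((hBs i).differentiable (by simp))]
  have tE := ptd_apply_eq_dirDeriv (hE.differentiable (by simp)) p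
  have tB := ptd_apply_eq_dirDeriv (hB.differentiable (by simp)) p
  have hct := retPot_kInv_continuity (c := c) hρ hρsupp hJ hJsupp hcont eTime p
  have hci := fun j => retPot_kInv_continuity (c := c) hρ hρsupp hJ hJsupp hcont (eSpace j) p
  have hwρ := retPot_kInv_wave (c := c) hρ hρsupp p
  have hwJ := fun i => retPot_kInv_wave (c := c) (hJc i) (hJcs i) p
  have ht := fun i j => dirDeriv_comm (hJc j) (eSpace i) eTime
  have htρ := fun i => dirDeriv_comm hρ (eSpace i) eTime
  have r10 := dirDeriv_comm hρ (eSpace 1) (eSpace 0)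
  have r20 := dirDeriv_comm hρ (eSpace 2) (eSpace 0)
  have r21 := dirDeriv_comm hρ (eSpace 2) (eSpace 1)
  have h10 := fun j => dirDeriv_comm (hJc j) (eSpace 1) (eSpace 0)
  have h20 := fun j => dirDeriv_comm (hJc j) (eSpace 2) (eSpace 0)
  have h21 := fun j => dirDeriv_comm (hJc j) (eSpace 2) (eSpace 1)
  simp only [Fin.sum_univ_three, hc2, htρ] at hct hci hwρ hwJ
  refine ⟨?_, ?_, ?_, ?_⟩
  · simp only [divg, Fin.sum_univ_three, pE, dE, ht]
    have hπ := Real.pi_pos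
    field_simp
    linear_combination -hwρ - μ₀ * ε₀ * hct
  · simp only [divg, Fin.sum_univ_three, pB, dB0, dB1, dB2, h10, h20, h21]
    ring
  · ext i
    rw [Pi.neg_apply, tB]
    fin_cases i <;>
      simp only [curl, Fin.zero_eta, Fin.mk_one, Fin.reduceFinMk, Matrix.cons_val, pE, dE, dB0, dB1,
        dB2, ht, r10, r20, r21] <;>
      ring
  · ext i
    rw [Pi.add_apply, Pi.smul_apply, Pi.smul_apply, tE, dE]
    have hJ0 := hwJ 0
    have hJ1 := hwJ 1
    have hJ2 := hwJ 2
    have hcJ0 := hci 0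
    have hcJ1 := hci 1
    have hcJ2 := hci 2
    simp only [h10, h20, h21] at hcJ0 hcJ1 hcJ2
    have hπ := Real.pi_pos
    fin_cases i <;>
      simp only [curl, Fin.zero_eta, Fin.mk_one, Fin.reduceFinMk, Matrix.cons_val, pB, dB0, dB1,
        dB2, h10, h20, h21, smul_eq_mul] <;> field_simp
    · linear_combination hcJ0 - hJ0
    · linear_combination hcJ1 - hJ1
    · linear_combination hcJ2 - hJ2
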